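/- Let B be an invertible bounded linear operator on a complex Hilbert space H. Then the linear reduction factor M_B equals inf_{λ ∈ ℂ} ‖I − λB‖, where I is the identity operator and the norm is the operator norm. -/

import Mathlib

noncomputable def gmresRes {H : Type*} [NormedAddCommGroup H] [NormedSpace ℂ H]
    (T : H →L[ℂ] H) (r0 : H) (k : ℕ) : ℝ :=
  sInf {x : ℝ | ∃ p : Polynomial ℂ,
    p.natDegree ≤ k ∧ p.eval 0 = 1 ∧ x = ‖(Polynomial.aeval T p) r0‖}

/-- The linear reduction factor `M_B`: the infimum of the constants `M ≥ 0`
such that every GMRES residual sequence for `B` satisfies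
`‖r_k‖ ≤ M * ‖r_{k-1}‖`. -/
noncomputable def linRed {H : Type*} [NormedAddCommGroup H] [NormedSpace ℂ H]
    (B : H →L[ℂ] H) : ℝ :=
  sInf {M : ℝ | 0 ≤ M ∧ ∀ (z : H) (k : ℕ), gmresRes B z (k + 1) ≤ M * gmresRes B z k}

lemma aux_psd (a b n1 n2 : ℝ) (ν : ℂ) (ha : 0 < a) (hb : 0 < b)
    (hN : ¬ (0 ≤ n1 ∧ 0 ≤ n2 ∧ ‖ν‖ ^ 2 ≤ n1 * n2)) :
    ∃ s : ℝ, 0 ≤ s ∧ ∃ α β : ℂ, ‖α‖ ^ 2 = a + s * n1 ∧ ‖β‖ ^ 2 = b + s * n2 ∧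
      (starRingEnd ℂ) α * β = s * ν := by
  set f : ℝ → ℝ := fun s => min (min (a + s * n1) (b + s * n2))
    ((a + s * n1) * (b + s * n2) - s ^ 2 * ‖ν‖ ^ 2) with hf
  have hcont : Continuous f := by fun_prop
  have h0 : 0 < f 0 := by simp [hf, ha, hb]
  have h1 : ∃ s1, 0 ≤ s1 ∧ f s1 ≤ 0 := by
    by_cases c1 : n1 < 0
    · refine ⟨a / (-n1), div_nonneg ha.le (by linarith), ?_⟩
      have : a + a / (-n1) * n1 = 0 := by
        have : n1 ≠ 0 := c1.ne
        field_simp; ring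
      simp only [hf]
      exact (min_le_left _ _).trans ((min_le_left _ _).trans this.le)
    by_cases c2 : n2 < 0
    · refine ⟨b / (-n2), div_nonneg hb.le (by linarith), ?_⟩
      have : b + b / (-n2) * n2 = 0 := by
        have : n2 ≠ 0 := c2.ne
        field_simp; ring
      simp only [hf]
      exact (min_le_left _ _).trans ((min_le_right _ _).trans this.le)
    push Not at c1 c2
    have c3 : n1 * n2 < ‖ν‖ ^ 2 := by
      by_contra h
      exact hN ⟨c1, c2, not_lt.mp h⟩
    set κ := ‖ν‖ ^ 2 - n1 * n2 with hκ
    have hκ0 : 0 < κ := by linarith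
    set m := (a * b + a * n2 + b * n1) / κ with hm
    have hm0 : 0 ≤ m := by positivity
    have hmk : m * κ = a * b + a * n2 + b * n1 := by
      rw [hm]; exact div_mul_cancel₀ _ hκ0.ne'
    refine ⟨1 + m, by positivity, ?_⟩
    simp only [hf]
    refine (min_le_right _ _).trans ?_
    have e : (a + (1 + m) * n1) * (b + (1 + m) * n2) - (1 + m) ^ 2 * ‖ν‖ ^ 2
        = a * b + (1 + m) * (a * n2 + b * n1) - (1 + m) ^ 2 * κ := by rw [hκ]; ring
    rw [e]
    have e2 : (1 + m) ^ 2 * κ = (1 + m) * κ + (1 + m) * (a * b + a * n2 + b * n1) := by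
      rw [← hmk]; ring
    rw [e2]
    have : 0 ≤ (1 + m) * κ := by positivity
    have : 0 ≤ m * (a * b) := by positivity
    nlinarith
  obtain ⟨s1, hs1, hfs1⟩ := h1
  obtain ⟨s, hs, hfs⟩ := intermediate_value_Icc' hs1 hcont.continuousOn ⟨hfs1, h0.le⟩
  have hs0 := hs.1
  set p := a + s * n1 with hp
  set q := b + s * n2 with hq
  have hfs' : min (min p q) (p * q - s ^ 2 * ‖ν‖ ^ 2) = 0 := hfs
  have hp0 : 0 ≤ p := hfs'.ge.trans ((min_le_left _ _).trans (min_le_left _ _))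
  have hq0 : 0 ≤ q := hfs'.ge.trans ((min_le_left _ _).trans (min_le_right _ _))
  have hD0 : 0 ≤ p * q - s ^ 2 * ‖ν‖ ^ 2 := hfs'.ge.trans (min_le_right _ _)
  have hsn : 0 ≤ s ^ 2 * ‖ν‖ ^ 2 := by positivity
  have hD : p * q = s ^ 2 * ‖ν‖ ^ 2 := by
    rcases min_choice (min p q) (p * q - s ^ 2 * ‖ν‖ ^ 2) with h | h
    · rw [h] at hfs'
      rcases min_choice p q with h' | h' <;> rw [h'] at hfs' <;> rw [hfs'] at hD0 ⊢ <;> linarith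
    · linarith
  refine ⟨s, hs0, ?_⟩
  by_cases hpz : p = 0
  · refine ⟨0, (Real.sqrt q : ℂ), by rw [← hp, hpz]; simp, ?_, ?_⟩
    · rw [Complex.norm_real, Real.norm_eq_abs, sq_abs, Real.sq_sqrt hq0]
    · rw [hpz, zero_mul] at hD
      have : (s * ν : ℂ) = 0 := by
        rw [← norm_eq_zero, ← sq_eq_zero_iff, norm_mul, mul_pow, Complex.norm_real,
          Real.norm_eq_abs, sq_abs]
        exact hD.symm
      simp [this]
  · have hpp : 0 < p := lt_of_le_of_ne hp0 (Ne.symm hpz)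
    have hsq : (Real.sqrt p : ℂ) ≠ 0 := by
      exact_mod_cast (Real.sqrt_pos.mpr hpp).ne'
    refine ⟨(Real.sqrt p : ℂ), s * ν / (Real.sqrt p : ℂ), ?_, ?_, ?_⟩
    · rw [Complex.norm_real, Real.norm_eq_abs, sq_abs, Real.sq_sqrt hp0]
    · rw [norm_div, norm_mul, div_pow, mul_pow, Complex.norm_real, Complex.norm_real,
        Real.norm_eq_abs, sq_abs, Real.norm_eq_abs, sq_abs, Real.sq_sqrt hp0, ← hD]
      rw [← hq]
      field_simp
    · rw [Complex.conj_ofReal]; field_simp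

section
variable {H : Type*} [NormedAddCommGroup H] [InnerProductSpace ℂ H]

lemma aux_inner (A B : H →L[ℂ] H) (x y : H) (α β : ℂ) :
    inner ℂ (A (α • x + β • y)) (B (α • x + β • y)) =
      ((‖α‖ ^ 2 : ℝ) : ℂ) * inner ℂ (A x) (B x) + ((‖β‖ ^ 2 : ℝ) : ℂ) * inner ℂ (A y) (B y)
      + ((starRingEnd ℂ) α * β) * inner ℂ (A x) (B y)
      + (starRingEnd ℂ) ((starRingEnd ℂ) α * β) * inner ℂ (A y) (B x) := by
  have h1 : ((‖α‖ ^ 2 : ℝ) : ℂ) = (starRingEnd ℂ) α * α := by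
    rw [Complex.conj_mul']; push_cast; rfl
  have h2 : ((‖β‖ ^ 2 : ℝ) : ℂ) = (starRingEnd ℂ) β * β := by
    rw [Complex.conj_mul']; push_cast; rfl
  rw [h1, h2]
  simp only [map_add, map_smul, inner_add_left, inner_add_right, inner_smul_left,
    inner_smul_right, map_mul, Complex.conj_conj]
  ring

lemma aux_norm (A : H →L[ℂ] H) (x y : H) (α β : ℂ) :
    ‖A (α • x + β • y)‖ ^ 2 = ‖α‖ ^ 2 * ‖A x‖ ^ 2 + ‖β‖ ^ 2 * ‖A y‖ ^ 2
      + 2 * (((starRingEnd ℂ) α * β) * inner ℂ (A x) (A y)).re := by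
  have h := congrArg Complex.re (aux_inner A A x y α β)
  have e : ∀ v : H, inner ℂ v v = ((‖v‖ ^ 2 : ℝ) : ℂ) := fun v => by
    rw [inner_self_eq_norm_sq_to_K]; push_cast; rfl
  rw [e, e, e, ← inner_conj_symm (A y) (A x), ← map_mul] at h
  simp only [Complex.add_re, ← Complex.ofReal_mul, Complex.ofReal_re, Complex.conj_re] at h
  linarith

lemma aux_convex (A B : H →L[ℂ] H) (c : ℝ) :
    Convex ℝ {w : ℂ | ∃ x : H, ‖x‖ = 1 ∧ c ≤ ‖A x‖ ^ 2 ∧ inner ℂ (A x) (B x) = w} := by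
  rw [convex_iff_forall_pos]
  rintro w1 ⟨x, hx, hcx, rfl⟩ w2 ⟨y, hy, hcy, rfl⟩ a b ha hb hab
  by_cases hg : ‖(inner ℂ x y : ℂ)‖ = 1
  · have hx0 : x ≠ 0 := by rintro rfl; simp at hx
    have hy0 : y ≠ 0 := by rintro rfl; simp at hy
    have := (norm_inner_eq_norm_iff (𝕜 := ℂ) hx0 hy0).1 (by rw [hg, hx, hy, one_mul])
    obtain ⟨r, hr, rfl⟩ := this
    have hr1 : ‖r‖ = 1 := by rw [norm_smul, hx, mul_one] at hy; exact hy
    refine ⟨x, hx, hcx, ?_⟩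
    have : inner ℂ (A (r • x)) (B (r • x)) = inner ℂ (A x) (B x) := by
      rw [map_smul, map_smul, inner_smul_left, inner_smul_right, ← mul_assoc, Complex.conj_mul',
        hr1]
      simp
    rw [this, ← add_smul, hab, one_smul]
  have hg1 : ‖(inner ℂ x y : ℂ)‖ < 1 := by
    refine lt_of_le_of_ne ?_ hg
    simpa [hx, hy] using norm_inner_le_norm (𝕜 := ℂ) x y
  let L : (ℝ × ℝ × ℂ) →ₗ[ℝ] (ℝ × ℂ) :=
    { toFun := fun n => (n.1 + n.2.1 + 2 * (n.2.2 * inner ℂ x y).re,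
        (n.1 : ℂ) * inner ℂ (A x) (B x) + (n.2.1 : ℂ) * inner ℂ (A y) (B y)
          + n.2.2 * inner ℂ (A x) (B y) + (starRingEnd ℂ) n.2.2 * inner ℂ (A y) (B x))
      map_add' := by
        rintro ⟨a1, b1, c1⟩ ⟨a2, b2, c2⟩
        ext1
        · simp only [Prod.mk_add_mk, add_mul, Complex.add_re]; ring
        · simp only [Prod.mk_add_mk, map_add, Complex.ofReal_add]; ring
      map_smul' := by
        rintro r ⟨a1, b1, c1⟩
        ext1
        · simp only [Prod.smul_mk, smul_mul_assoc, Complex.smul_re, smul_eq_mul, RingHom.id_apply]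
          ring
        · simp only [Prod.smul_mk, Complex.real_smul, smul_eq_mul, RingHom.id_apply, map_mul,
            Complex.ofReal_mul, Complex.conj_ofReal]
          ring }
  have hker : LinearMap.ker L ≠ ⊥ := by
    apply LinearMap.ker_ne_bot_of_finrank_lt
    simp [Module.finrank_prod, Complex.finrank_real_complex]
  obtain ⟨n0, hn0, hn0'⟩ := Submodule.exists_mem_ne_zero_of_ne_bot hker
  let Q : ℝ × ℝ × ℂ → ℝ := fun n => n.1 * ‖A x‖ ^ 2 + n.2.1 * ‖A y‖ ^ 2
    + 2 * (n.2.2 * inner ℂ (A x) (A y)).re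
  have hQneg : ∀ n, Q (-n) = - Q n := by
    intro n
    simp only [Q, Prod.fst_neg, Prod.snd_neg, neg_mul, Complex.neg_re]; ring
  obtain ⟨n, hn, hnz, hnQ⟩ : ∃ n, L n = 0 ∧ n ≠ 0 ∧ 0 ≤ Q n := by
    rcases le_total 0 (Q n0) with h | h
    · exact ⟨n0, hn0, hn0', h⟩
    · refine ⟨-n0, ?_, neg_ne_zero.mpr hn0', ?_⟩
      · rw [map_neg, LinearMap.mem_ker.1 hn0, neg_zero]
      · rw [hQneg]; linarith
  obtain ⟨n1, n2, ν⟩ := n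
  have hL1 : n1 + n2 + 2 * (ν * inner ℂ x y).re = 0 := congrArg Prod.fst hn
  have hL2 : (n1 : ℂ) * inner ℂ (A x) (B x) + (n2 : ℂ) * inner ℂ (A y) (B y)
          + ν * inner ℂ (A x) (B y) + (starRingEnd ℂ) ν * inner ℂ (A y) (B x) = 0 :=
    congrArg Prod.snd hn
  have hQ : 0 ≤ n1 * ‖A x‖ ^ 2 + n2 * ‖A y‖ ^ 2 + 2 * (ν * inner ℂ (A x) (A y)).re := hnQ
  have hN : ¬ (0 ≤ n1 ∧ 0 ≤ n2 ∧ ‖ν‖ ^ 2 ≤ n1 * n2) := by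
    rintro ⟨h1, h2, h3⟩
    have hre : -(‖ν‖ * ‖(inner ℂ x y : ℂ)‖) ≤ (ν * inner ℂ x y).re := by
      rw [← norm_mul]
      exact (abs_le.1 (Complex.abs_re_le_norm _)).1
    have hν : 2 * ‖ν‖ ≤ n1 + n2 := by
      refine le_of_sq_le_sq ?_ (by positivity)
      nlinarith [sq_nonneg (n1 - n2)]
    have hν0 : ‖ν‖ = 0 := by
      by_contra h
      have : 0 < ‖ν‖ := lt_of_le_of_ne (norm_nonneg _) (Ne.symm h)
      nlinarith
    have hsum : n1 + n2 ≤ 0 := by rw [hν0] at hre; linarith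
    apply hnz
    have e1 : n1 = 0 := by linarith
    have e2 : n2 = 0 := by linarith
    rw [e1, e2, norm_eq_zero.1 hν0]; rfl
  obtain ⟨s, hs, α, β, hα, hβ, hαβ⟩ := aux_psd a b n1 n2 ν ha hb hN
  refine ⟨α • x + β • y, ?_, ?_, ?_⟩
  · have := aux_norm (1 : H →L[ℂ] H) x y α β
    simp only [one_apply_eq_self] at this
    rw [hα, hβ, hαβ, hx, hy, mul_assoc, Complex.re_ofReal_mul] at this
    have h1 : ‖α • x + β • y‖ ^ 2 = 1 := by
      rw [this]; linear_combination hab + s * hL1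
    exact (pow_eq_one_iff_of_nonneg (norm_nonneg _) two_ne_zero).1 h1
  · rw [aux_norm, hα, hβ, hαβ, mul_assoc, Complex.re_ofReal_mul]
    have := mul_nonneg hs hQ
    have h1 := mul_le_mul_of_nonneg_left hcx ha.le
    have h2 := mul_le_mul_of_nonneg_left hcy hb.le
    have h3 : a * c + b * c = c := by rw [← add_mul, hab, one_mul]
    linarith
  · rw [aux_inner, hα, hβ, hαβ, map_mul, Complex.conj_ofReal, Complex.real_smul, Complex.real_smul]
    push_cast
    linear_combination (s : ℂ) * hL2

lemma aux_expand (u v : H) (μ : ℂ) :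
    ‖u - μ • v‖ ^ 2 = ‖u‖ ^ 2 - 2 * (μ * inner ℂ u v).re + ‖μ‖ ^ 2 * ‖v‖ ^ 2 := by
  rw [norm_sub_sq (𝕜 := ℂ), inner_smul_right, norm_smul, mul_pow]; rfl

/-- Approximate Bhatia-Semrl type statement. -/
lemma aux_main (A B : H →L[ℂ] H) (hmin : ∀ μ : ℂ, ‖A‖ ≤ ‖A - μ • B‖) (hA : 0 < ‖A‖)
    (δ ε : ℝ) (hδ : 0 < δ) (hε : 0 < ε) :
    ∃ x : H, ‖x‖ = 1 ∧ ‖A‖ ^ 2 - δ ≤ ‖A x‖ ^ 2 ∧ ‖(inner ℂ (A x) (B x) : ℂ)‖ < ε := by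
  by_contra hcon
  push Not at hcon
  have hdisj : Disjoint (Metric.ball (0 : ℂ) ε)
      {w : ℂ | ∃ x : H, ‖x‖ = 1 ∧ ‖A‖ ^ 2 - δ ≤ ‖A x‖ ^ 2 ∧ inner ℂ (A x) (B x) = w} := by
    rw [Set.disjoint_left]
    rintro w hw ⟨x, hx, hcx, rfl⟩
    have := hcon x hx hcx
    rw [mem_ball_zero_iff] at hw
    linarith
  obtain ⟨f, u, hf1, hf2⟩ := geometric_hahn_banach_open (convex_ball (0 : ℂ) ε)
    Metric.isOpen_ball (aux_convex A B (‖A‖ ^ 2 - δ)) hdisj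
  have hu : 0 < u := by simpa using hf1 0 (by simpa using hε)
  set ν : ℂ := ⟨f 1, - f Complex.I⟩ with hν
  have hfν : ∀ w : ℂ, f w = (ν * w).re := by
    intro w
    have : w = w.re • (1 : ℂ) + w.im • Complex.I := by
      simp [Complex.re_add_im]
    conv_lhs => rw [this]
    rw [map_add, map_smul, map_smul]
    simp [hν, Complex.mul_re]; ring
  set K := ‖ν‖ ^ 2 * ‖B‖ ^ 2 with hK
  have hK0 : 0 ≤ K := by positivity
  set R := ‖ν‖ * (‖A‖ * ‖B‖) with hR
  have hR0 : 0 ≤ R := by positivity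
  obtain ⟨t, ht0, htK, htδ⟩ : ∃ t : ℝ, 0 < t ∧ t * K ≤ u ∧ t * (2 * u + 2 * R) ≤ δ := by
    refine ⟨min (u / (K + 1)) (δ / (2 * u + 2 * R)), by positivity, ?_, ?_⟩
    · calc _ ≤ u / (K + 1) * K := by gcongr; exact min_le_left _ _
        _ ≤ u / (K + 1) * (K + 1) := by gcongr; linarith
        _ = u := by field_simp
    · calc _ ≤ δ / (2 * u + 2 * R) * (2 * u + 2 * R) := by gcongr; exact min_le_right _ _
        _ = δ := by field_simp
  have key : ∀ x : H, ‖x‖ = 1 → ‖(A - ((t : ℂ) * ν) • B) x‖ ^ 2 ≤ ‖A‖ ^ 2 - t * u := by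
    intro x hx
    have hAx : ‖A x‖ ≤ ‖A‖ := by simpa [hx] using A.le_opNorm x
    have hBx : ‖B x‖ ≤ ‖B‖ := by simpa [hx] using B.le_opNorm x
    have e : ‖(A - ((t : ℂ) * ν) • B) x‖ ^ 2 =
        ‖A x‖ ^ 2 - 2 * (t * (ν * inner ℂ (A x) (B x)).re) + t ^ 2 * (‖ν‖ ^ 2 * ‖B x‖ ^ 2) := by
      have := aux_expand (A x) (B x) ((t : ℂ) * ν)
      rw [mul_assoc, Complex.re_ofReal_mul, norm_mul, mul_pow, Complex.norm_real, Real.norm_eq_abs,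
        sq_abs, mul_assoc] at this
      exact this
    rw [e]
    have hk : t ^ 2 * (‖ν‖ ^ 2 * ‖B x‖ ^ 2) ≤ t * u := by
      calc t ^ 2 * (‖ν‖ ^ 2 * ‖B x‖ ^ 2) ≤ t ^ 2 * (‖ν‖ ^ 2 * ‖B‖ ^ 2) := by gcongr
        _ = t * (t * K) := by rw [hK]; ring
        _ ≤ t * u := by gcongr
    by_cases hc : ‖A‖ ^ 2 - δ ≤ ‖A x‖ ^ 2
    · have h1 := hf2 _ ⟨x, hx, hc, rfl⟩
      rw [hfν] at h1
      have h2 := mul_le_mul_of_nonneg_left h1 ht0.le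
      have h3 : ‖A x‖ ^ 2 ≤ ‖A‖ ^ 2 := by gcongr
      linarith
    · push Not at hc
      have h1 : -R ≤ (ν * inner ℂ (A x) (B x)).re := by
        have h2 := (abs_le.1 (Complex.abs_re_le_norm (ν * inner ℂ (A x) (B x)))).1
        have h3 : ‖ν * inner ℂ (A x) (B x)‖ ≤ R := by
          rw [norm_mul, hR]
          have := norm_inner_le_norm (𝕜 := ℂ) (A x) (B x)
          have h4 : ‖A x‖ * ‖B x‖ ≤ ‖A‖ * ‖B‖ := by gcongr
          gcongr; linarith
        linarith
      have h2 := mul_le_mul_of_nonneg_left h1 ht0.le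
      linarith
  have hsq : 0 ≤ ‖A‖ ^ 2 - t * u := by
    by_contra h
    push Not at h
    have hz : A = 0 := by
      have : Subsingleton H := by
        refine subsingleton_of_forall_eq 0 fun x => ?_
        by_contra hx
        have hx' : ‖x‖ ≠ 0 := norm_ne_zero_iff.mpr hx
        have := key (((‖x‖⁻¹ : ℝ) : ℂ) • x) (by rw [norm_smul]; simp [hx'])
        have := sq_nonneg ‖(A - ((t : ℂ) * ν) • B) (((‖x‖⁻¹ : ℝ) : ℂ) • x)‖
        linarith
      exact Subsingleton.elim _ _
    rw [hz] at hA; simp at hA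
  have hle : ‖A - ((t : ℂ) * ν) • B‖ ≤ Real.sqrt (‖A‖ ^ 2 - t * u) := by
    refine ContinuousLinearMap.opNorm_le_bound _ (Real.sqrt_nonneg _) fun x => ?_
    by_cases hx : x = 0
    · simp [hx]
    have hx' : ‖x‖ ≠ 0 := norm_ne_zero_iff.mpr hx
    have h1 := Real.le_sqrt_of_sq_le
      (key (((‖x‖⁻¹ : ℝ) : ℂ) • x) (by rw [norm_smul]; simp [hx']))
    rw [map_smul, norm_smul, Complex.norm_real, norm_inv, norm_norm,
      inv_mul_le_iff₀ (by positivity)] at h1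
    linarith
  have h1 := (hmin _).trans hle
  have h2 := (Real.le_sqrt hA.le hsq).1 h1
  nlinarith [mul_pos ht0 hu]

end

lemma gmres_bdd {H : Type*} [NormedAddCommGroup H] [NormedSpace ℂ H]
    (T : H →L[ℂ] H) (r0 : H) (k : ℕ) : BddBelow {x : ℝ | ∃ p : Polynomial ℂ,
    p.natDegree ≤ k ∧ p.eval 0 = 1 ∧ x = ‖(Polynomial.aeval T p) r0‖} :=
  ⟨0, by rintro x ⟨p, _, _, rfl⟩; exact norm_nonneg _⟩

lemma gmres_ne {H : Type*} [NormedAddCommGroup H] [NormedSpace ℂ H]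
    (T : H →L[ℂ] H) (r0 : H) (k : ℕ) : {x : ℝ | ∃ p : Polynomial ℂ,
    p.natDegree ≤ k ∧ p.eval 0 = 1 ∧ x = ‖(Polynomial.aeval T p) r0‖}.Nonempty :=
  ⟨_, 1, by simp, by simp, rfl⟩

lemma gmres_upper {H : Type*} [NormedAddCommGroup H] [NormedSpace ℂ H]
    (T : H →L[ℂ] H) (z : H) (k : ℕ) (lam : ℂ) :
    gmresRes T z (k + 1) ≤ ‖(1 : H →L[ℂ] H) - lam • T‖ * gmresRes T z k := by
  have h : ∀ x ∈ {x : ℝ | ∃ p : Polynomial ℂ,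
      p.natDegree ≤ k ∧ p.eval 0 = 1 ∧ x = ‖(Polynomial.aeval T p) z‖},
      gmresRes T z (k + 1) ≤ ‖(1 : H →L[ℂ] H) - lam • T‖ * x := by
    rintro x ⟨p, hp, hp0, rfl⟩
    have h1 : gmresRes T z (k + 1) ≤
        ‖(Polynomial.aeval T ((1 - Polynomial.C lam * Polynomial.X) * p)) z‖ := by
      refine csInf_le (gmres_bdd T z (k + 1)) ⟨_, ?_, ?_, rfl⟩
      · refine Polynomial.natDegree_mul_le.trans ?_
        have : (1 - Polynomial.C lam * Polynomial.X : Polynomial ℂ).natDegree ≤ 1 := by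
          compute_degree
        omega
      · simp [hp0]
    refine h1.trans ?_
    rw [map_mul, mul_apply_eq_comp]
    have e : Polynomial.aeval T (1 - Polynomial.C lam * Polynomial.X) = 1 - lam • T := by
      simp [Algebra.smul_def]
    rw [e]
    exact ContinuousLinearMap.le_opNorm _ _
  rcases (norm_nonneg ((1 : H →L[ℂ] H) - lam • T)).eq_or_lt with h0 | h0
  · obtain ⟨x, hx⟩ := gmres_ne T z k
    have := h x hx
    rw [← h0] at this ⊢
    linarith
  · rw [← div_le_iff₀' h0]
    refine le_csInf (gmres_ne T z k) fun x hx => ?_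
    rw [div_le_iff₀' h0]
    exact h x hx

lemma gmres_lower {H : Type*} [NormedAddCommGroup H] [NormedSpace ℂ H]
    (T : H →L[ℂ] H) (z : H) (c : ℝ) (h : gmresRes T z 1 < c) :
    ∃ lam : ℂ, ‖z - lam • T z‖ < c := by
  obtain ⟨x, ⟨p, hp, hp0, rfl⟩, hx⟩ := exists_lt_of_csInf_lt (gmres_ne T z 1) h
  refine ⟨-p.coeff 1, ?_⟩
  have e : p = Polynomial.C (p.coeff 1) * Polynomial.X + Polynomial.C (p.coeff 0) :=
    Polynomial.eq_X_add_C_of_natDegree_le_one hp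
  have h0 : p.coeff 0 = 1 := by rw [Polynomial.coeff_zero_eq_eval_zero, hp0]
  have e2 : Polynomial.aeval T p = p.coeff 1 • T + 1 := by
    conv_lhs => rw [e, h0]
    simp [Algebra.smul_def]
  rw [e2] at hx
  simpa [add_comm] using hx

/-- Proposition 3.1, first equality in (3.1): the linear reduction factor of an
invertible bounded operator `B` equals `inf_{λ ∈ ℂ} ‖I - λB‖`. -/
theorem linRed_eq_iInf_norm_one_sub_smul
    {H : Type*} [NormedAddCommGroup H] [InnerProductSpace ℂ H] [CompleteSpace H]
    (B : H ≃L[ℂ] H) :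
    linRed (B : H →L[ℂ] H) =
      ⨅ lam : ℂ, ‖(1 : H →L[ℂ] H) - lam • (B : H →L[ℂ] H)‖ := by
  set T : H →L[ℂ] H := (B : H →L[ℂ] H) with hT
  have hbddR : BddBelow (Set.range fun lam : ℂ => ‖(1 : H →L[ℂ] H) - lam • T‖) :=
    ⟨0, by rintro _ ⟨l, rfl⟩; exact norm_nonneg _⟩
  have hbdd : BddBelow {M : ℝ | 0 ≤ M ∧ ∀ (z : H) (k : ℕ),
      gmresRes T z (k + 1) ≤ M * gmresRes T z k} := ⟨0, fun M hM => hM.1⟩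
  apply le_antisymm
  · exact le_ciInf fun lam => csInf_le hbdd ⟨norm_nonneg _, fun z k => gmres_upper T z k lam⟩
  refine le_csInf ⟨_, norm_nonneg _, fun z k => gmres_upper T z k 0⟩ ?_
  rintro M ⟨hM0, hM⟩
  by_contra hlt
  push Not at hlt
  rcases subsingleton_or_nontrivial H with hH | hH
  · have h1 := ciInf_le hbddR 0
    have h2 : ‖(1 : H →L[ℂ] H) - (0 : ℂ) • T‖ = 0 := by
      rw [norm_eq_zero]; exact Subsingleton.elim _ _
    simp only [h2] at h1
    linarith
  have hTne : 0 < ‖T‖ := by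
    rw [norm_pos_iff]
    intro h
    obtain ⟨x, hx⟩ := exists_ne (0 : H)
    apply hx
    apply B.injective
    have := congrArg (fun S : H →L[ℂ] H => S x) h
    simpa [hT] using this
  have hcont : Continuous fun lam : ℂ => ‖(1 : H →L[ℂ] H) - lam • T‖ := by fun_prop
  have htend : Filter.Tendsto (fun lam : ℂ => ‖(1 : H →L[ℂ] H) - lam • T‖)
      (Filter.cocompact ℂ) Filter.atTop := by
    have h1 : Filter.Tendsto (fun lam : ℂ => ‖lam‖ * ‖T‖ + (-‖(1 : H →L[ℂ] H)‖))
        (Filter.cocompact ℂ) Filter.atTop :=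
      Filter.tendsto_atTop_add_const_right _ _
        ((tendsto_norm_cocompact_atTop (E := ℂ)).atTop_mul_const hTne)
    refine Filter.tendsto_atTop_mono (fun lam => ?_) h1
    have := norm_sub_norm_le (lam • T) (1 : H →L[ℂ] H)
    rw [norm_smul, norm_sub_rev] at this
    linarith
  obtain ⟨l0, hl0⟩ := hcont.exists_forall_le htend
  set A := (1 : H →L[ℂ] H) - l0 • T with hA
  have hd : M < ‖A‖ := hlt.trans_le (ciInf_le hbddR l0)
  have hmin : ∀ μ : ℂ, ‖A‖ ≤ ‖A - μ • T‖ := by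
    intro μ
    have := hl0 (l0 + μ)
    rw [add_smul, ← sub_sub] at this
    exact this
  obtain ⟨M', hM1, hM2⟩ := exists_between hd
  -- lower bound for T
  obtain ⟨b, hb0, hb⟩ : ∃ b : ℝ, 0 < b ∧ ∀ x : H, ‖x‖ = 1 → b ≤ ‖T x‖ := by
    refine ⟨(‖(B.symm : H →L[ℂ] H)‖ + 1)⁻¹, by positivity, fun x hx => ?_⟩
    have h1 := (B.symm : H →L[ℂ] H).le_opNorm (T x)
    have h2 : (B.symm : H →L[ℂ] H) (T x) = x := by simp [hT]
    rw [h2, hx] at h1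
    rw [inv_le_iff_one_le_mul₀ (by positivity)]
    nlinarith [norm_nonneg (T x)]
  set δ := (‖A‖ ^ 2 - M' ^ 2) / 2 with hδ
  have hδ0 : 0 < δ := by
    have : M' ^ 2 < ‖A‖ ^ 2 := by gcongr; linarith
    linarith
  obtain ⟨x, hx, hxA, hxi⟩ := aux_main A T hmin (by linarith) δ (b * Real.sqrt δ) hδ0
    (by positivity)
  have hr0 : gmresRes T x 0 ≤ 1 := by
    refine csInf_le (gmres_bdd T x 0) ⟨1, by simp, by simp, by simp [hx]⟩
  have hr1 : gmresRes T x 1 < M' := by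
    have := hM x 0
    rw [zero_add] at this
    have := mul_le_mul_of_nonneg_left hr0 hM0
    linarith
  obtain ⟨lam, hlam⟩ := gmres_lower T x M' hr1
  have e : x - lam • T x = A x - (lam - l0) • T x := by
    simp [hA, sub_smul]
  rw [e] at hlam
  set μ := lam - l0
  have hsq : ‖A x - μ • T x‖ ^ 2 < M' ^ 2 := by gcongr
  rw [aux_expand] at hsq
  have h1 : (μ * inner ℂ (A x) (T x)).re ≤ ‖μ‖ * (b * Real.sqrt δ) := by
    refine (Complex.re_le_norm _).trans ?_
    rw [norm_mul]; gcongr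
  have h2 : ‖μ‖ ^ 2 * b ^ 2 ≤ ‖μ‖ ^ 2 * ‖T x‖ ^ 2 := by gcongr; exact hb x hx
  have h3 := Real.sq_sqrt hδ0.le
  nlinarith [sq_nonneg (‖μ‖ * b - Real.sqrt δ)]
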